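/- Define v : ℝ² → ℝ by v(x,y) = x·y − x⁴/4 − (3/4)·y·cbrt(y), where cbrt denotes the real cube root. Then: (i) v is continuously differentiable on ℝ² with ∂v/∂x = y − x³ and ∂v/∂y = x − cbrt(y); (ii) ∂²v/∂y∂x = 1 at every point of ℝ²; (iii) v vanishes to second order on the curve γ = {(x, x³) : x ∈ ℝ}, i.e., v(x, x³) = 0, (∂v/∂x)(x, x³) = 0, and (∂v/∂y)(x, x³) = 0 for all x ∈ ℝ; and (iv) for y ≠ 0, ∂²v/∂y² = −(1/3)·y^{−2/3}, which is unbounded as y → 0, so v fails to be twice differentiable in y along the characteristic line {y = 0} tangent to γ at the origin. -/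

import Mathlib

open Filter

/-- The real cube root: `cbrt y = sign(y)·|y|^{1/3}`. -/
noncomputable def cbrt (y : ℝ) : ℝ := Real.sign y * |y| ^ ((1 : ℝ) / 3)

/-- The explicit solution `v(x,y) = xy − x⁴/4 − (3/4)·y·cbrt(y)` of the characteristic
Cauchy problem `v_{xy} = 1`, `v ≡_γ 0` on `γ = {y = x³}` from Section 5. -/
noncomputable def v (x y : ℝ) : ℝ := x * y - x ^ 4 / 4 - 3 / 4 * (y * cbrt y)

theorem cbrt_of_nonneg {y : ℝ} (hy : 0 ≤ y) : cbrt y = y ^ ((1 : ℝ) / 3) := by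
  rcases hy.eq_or_lt with rfl | hy
  · simp [cbrt]
  · rw [cbrt, Real.sign_of_pos hy, abs_of_pos hy, one_mul]

theorem cbrt_neg (y : ℝ) : cbrt (-y) = -cbrt y := by
  simp [cbrt, Real.sign_neg]

theorem continuous_cbrt : Continuous cbrt := by
  have h : cbrt = fun y => max y 0 ^ ((1 : ℝ) / 3) - max (-y) 0 ^ ((1 : ℝ) / 3) := by
    funext y
    rcases le_total 0 y with hy | hy
    · rw [cbrt_of_nonneg hy, max_eq_left hy, max_eq_right (neg_nonpos.2 hy),
        Real.zero_rpow (by norm_num), sub_zero]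
    · have hy' := neg_nonneg.2 hy
      rw [← neg_neg y, cbrt_neg, cbrt_of_nonneg hy', neg_neg, max_eq_right hy, max_eq_left hy',
        Real.zero_rpow (by norm_num), zero_sub]
  rw [h]
  exact ((continuous_id.max continuous_const).rpow_const fun _ => Or.inr (by norm_num)).sub
    ((continuous_neg.max continuous_const).rpow_const fun _ => Or.inr (by norm_num))

theorem cbrt_pow_three (x : ℝ) : cbrt (x ^ 3) = x := by
  have key : ∀ {z : ℝ}, 0 ≤ z → cbrt (z ^ 3) = z := fun {z} hz => by
    rw [cbrt_of_nonneg (pow_nonneg hz 3), one_div]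
    exact_mod_cast Real.pow_rpow_inv_natCast hz three_ne_zero
  rcases le_total 0 x with hx | hx
  · exact key hx
  · have h := key (neg_nonneg.2 hx)
    rw [Odd.neg_pow (by decide), cbrt_neg] at h
    exact neg_injective h

theorem hasDerivAt_cbrt_of_pos {y : ℝ} (hy : 0 < y) :
    HasDerivAt cbrt (1 / 3 * |y| ^ (-(2 : ℝ) / 3)) y := by
  have h := Real.hasDerivAt_rpow_const (p := (1 : ℝ) / 3) (Or.inl hy.ne')
  rw [abs_of_pos hy, show -(2 : ℝ) / 3 = 1 / 3 - 1 by norm_num]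
  refine h.congr_of_eventuallyEq ?_
  filter_upwards [lt_mem_nhds hy] with z hz using cbrt_of_nonneg hz.le

theorem hasDerivAt_cbrt {y : ℝ} (hy : y ≠ 0) :
    HasDerivAt cbrt (1 / 3 * |y| ^ (-(2 : ℝ) / 3)) y := by
  rcases hy.lt_or_gt with hy | hy
  · have h := ((hasDerivAt_cbrt_of_pos (neg_pos.2 hy)).scomp y (hasDerivAt_neg y)).neg
    rw [abs_neg, neg_one_smul, neg_neg] at h
    exact h.congr_of_eventuallyEq (.of_forall fun z => by simp [cbrt_neg])
  · exact hasDerivAt_cbrt_of_pos hy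

theorem self_mul_abs_rpow {y : ℝ} (hy : y ≠ 0) : y * |y| ^ (-(2 : ℝ) / 3) = cbrt y := by
  have h : |y| ^ ((1 : ℝ) / 3) = |y| * |y| ^ (-(2 : ℝ) / 3) := by
    rw [show (1 : ℝ) / 3 = 1 + -(2 : ℝ) / 3 by norm_num, Real.rpow_add (abs_pos.2 hy),
      Real.rpow_one]
  rw [cbrt, h, ← mul_assoc]
  congr 1
  rcases hy.lt_or_gt with hy | hy
  · rw [Real.sign_of_neg hy, abs_of_neg hy]; ring
  · rw [Real.sign_of_pos hy, abs_of_pos hy, one_mul]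

theorem hasDerivAt_mul_cbrt (y : ℝ) :
    HasDerivAt (fun s => s * cbrt s) (4 / 3 * cbrt y) y := by
  refine hasDerivAt_of_hasDerivAt_of_ne' (x := 0) (g := fun s => 4 / 3 * cbrt s)
    (fun z hz => ?_) (continuous_id.mul continuous_cbrt).continuousAt
    (continuous_const.mul continuous_cbrt).continuousAt y
  refine ((hasDerivAt_id' z).mul (hasDerivAt_cbrt hz)).congr_deriv ?_
  linear_combination (1 / 3) * self_mul_abs_rpow hz

theorem contDiff_mul_cbrt : ContDiff ℝ 1 fun s => s * cbrt s := by
  rw [contDiff_one_iff_deriv]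
  refine ⟨fun y => (hasDerivAt_mul_cbrt y).differentiableAt, ?_⟩
  rw [funext fun y => (hasDerivAt_mul_cbrt y).deriv]
  exact continuous_const.mul continuous_cbrt

theorem hasDerivAt_v_fst (x y : ℝ) : HasDerivAt (fun s => v s y) (y - x ^ 3) x := by
  refine ((((hasDerivAt_id x).mul_const y).sub ((hasDerivAt_pow 4 x).div_const 4)).sub_const
    (3 / 4 * (y * cbrt y))).congr_deriv ?_
  norm_num

theorem hasDerivAt_v_snd (x y : ℝ) : HasDerivAt (fun s => v x s) (x - cbrt y) y := by
  refine ((((hasDerivAt_id y).const_mul x).sub_const (x ^ 4 / 4)).sub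
    ((hasDerivAt_mul_cbrt y).const_mul (3 / 4))).congr_deriv ?_
  ring

theorem tendsto_abs_rpow_neg_nhdsNE_zero {r : ℝ} (hr : r < 0) :
    Tendsto (fun y : ℝ => |y| ^ r) (nhdsWithin 0 {0}ᶜ) atTop :=
  (tendsto_rpow_neg_nhdsGT_zero hr).comp tendsto_abs_nhdsNE_zero

/-- Properties of the solution `v` of the characteristic Cauchy problem `v_{xy} = 1` with
`v` vanishing to second order on `γ = {(x,x³)}`:  (i) `v` is `C¹` on `ℝ²` with
`∂v/∂x = y − x³` and `∂v/∂y = x − cbrt y`; (ii) `∂²v/∂y∂x = 1` everywhere; (iii) `v` and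
its gradient vanish on `γ`; (iv) for `y ≠ 0`, `∂²v/∂y² = −(1/3)·|y|^{−2/3}`, which blows
up as `y → 0`: the solution is singular on the tangent characteristic `{y = 0}`. -/
theorem characteristic_cauchy_problem_solution :
    (ContDiff ℝ 1 fun p : ℝ × ℝ => v p.1 p.2) ∧
    (∀ x y : ℝ, HasDerivAt (fun s => v s y) (y - x ^ 3) x) ∧
    (∀ x y : ℝ, HasDerivAt (fun s => v x s) (x - cbrt y) y) ∧
    (∀ x y : ℝ, HasDerivAt (fun s => deriv (fun u => v u s) x) 1 y) ∧
    (∀ x : ℝ, v x (x ^ 3) = 0 ∧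
      deriv (fun u => v u (x ^ 3)) x = 0 ∧ deriv (fun s => v x s) (x ^ 3) = 0) ∧
    (∀ x y : ℝ, y ≠ 0 →
      HasDerivAt (fun s => deriv (fun u => v x u) s) (-(1 / 3) * |y| ^ (-(2 : ℝ) / 3)) y) ∧
    Tendsto (fun y : ℝ => |y| ^ (-(2 : ℝ) / 3)) (nhdsWithin 0 {0}ᶜ) atTop := by
  refine ⟨?_, hasDerivAt_v_fst, hasDerivAt_v_snd, fun x y => ?_, fun x => ⟨?_, ?_, ?_⟩,
    fun x y hy => ?_, tendsto_abs_rpow_neg_nhdsNE_zero (by norm_num)⟩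
  · exact ((contDiff_fst.mul contDiff_snd).sub ((contDiff_fst.pow 4).div_const 4)).sub
      (contDiff_const.mul (contDiff_mul_cbrt.comp contDiff_snd))
  · rw [funext fun s => (hasDerivAt_v_fst x s).deriv]
    exact (hasDerivAt_id y).sub_const _
  · rw [v, cbrt_pow_three]; ring
  · rw [(hasDerivAt_v_fst x _).deriv, sub_self]
  · rw [(hasDerivAt_v_snd x _).deriv, cbrt_pow_three, sub_self]
  · rw [funext fun s => (hasDerivAt_v_snd x s).deriv, neg_mul]
    exact (hasDerivAt_cbrt hy).const_sub x
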